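/- (Inter-sample derivative bound for the periodic law.) Let L be the Laplacian of a weight-balanced weighted digraph on N vertices with out-degrees dᵢ > 0, w_max = max_i max_{j∈𝒩ᵢ} wᵢⱼ, |𝒩_max| = max_i |𝒩ᵢ|, σᵢ ∈ (0,1), σ_max = max_i σᵢ, and h > 0. Let x̂, e ∈ ℝᴺ with eᵢ² ≤ (σᵢ/(4dᵢ)) Σⱼ wᵢⱼ(x̂ᵢ − x̂ⱼ)² for all i. Then for every s ∈ [0, h], −x̂ᵀ L x̂ + (e + s L x̂)ᵀ L x̂ ≤ ( (σ_max − 1)/2 + 2 h w_max |𝒩_max| ) · x̂ᵀ L x̂. -/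

import Mathlib

open Matrix Finset

section Laplacian

variable {ι : Type*} [Fintype ι] [DecidableEq ι]

/-- The Laplacian acts by weighted differences. -/
lemma laplacian_mulVec_apply (W : Matrix ι ι ℝ) (x : ι → ℝ) (i : ι) :
    ((diagonal (fun i => ∑ k, W i k) - W) *ᵥ x) i = ∑ j, W i j * (x i - x j) := by
  rw [sub_mulVec, Pi.sub_apply, mulVec_diagonal]
  simp only [mulVec, dotProduct, mul_sub, sum_sub_distrib, sum_mul]

/-- For a weight-balanced digraph, the quadratic form of the Laplacian is half the weighted sum of
squared differences. -/
lemma dotProduct_laplacian_mulVec (W : Matrix ι ι ℝ) (hbal : ∀ i, ∑ j, W i j = ∑ j, W j i)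
    (x : ι → ℝ) :
    x ⬝ᵥ (diagonal (fun i => ∑ k, W i k) - W) *ᵥ x =
      (∑ i, ∑ j, W i j * (x i - x j) ^ 2) / 2 := by
  have hswap : ∑ i, ∑ j, W i j * x j ^ 2 = ∑ i, ∑ j, W i j * x i ^ 2 := by
    rw [sum_comm]
    simp only [← sum_mul, hbal]
  have hexpand : ∑ i, ∑ j, W i j * (x i - x j) ^ 2 =
      2 * ∑ i, ∑ j, x i * (W i j * (x i - x j)) +
        (∑ i, ∑ j, W i j * x j ^ 2 - ∑ i, ∑ j, W i j * x i ^ 2) := by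
    simp only [mul_sum, ← sum_sub_distrib, ← sum_add_distrib]
    exact sum_congr rfl fun i _ => sum_congr rfl fun j _ => by ring
  simp only [dotProduct, laplacian_mulVec_apply, mul_sum] at hexpand ⊢
  rw [hexpand, hswap]
  simp only [← mul_sum]
  ring

end Laplacian

/-- Cauchy–Schwarz for a weighted sum. -/
lemma sq_sum_mul_le_sum_mul_sum_mul_sq {ι : Type*} (s : Finset ι) (w y : ι → ℝ)
    (hw : ∀ j ∈ s, 0 ≤ w j) :
    (∑ j ∈ s, w j * y j) ^ 2 ≤ (∑ j ∈ s, w j) * ∑ j ∈ s, w j * y j ^ 2 :=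
  sum_sq_le_sum_mul_sum_of_sq_le_mul s hw (fun j hj => mul_nonneg (hw j hj) (sq_nonneg _))
    fun j _ => le_of_eq (by ring)

/-- Young's inequality, summed against nonnegative weights. -/
lemma mul_sum_mul_le {ι : Type*} (s : Finset ι) (w y : ι → ℝ) (hw : ∀ j ∈ s, 0 ≤ w j) (a : ℝ) :
    a * ∑ j ∈ s, w j * y j ≤ (∑ j ∈ s, w j) * a ^ 2 + (∑ j ∈ s, w j * y j ^ 2) / 4 := by
  rw [mul_sum, sum_mul, sum_div, ← sum_add_distrib]
  exact sum_le_sum fun j hj => by nlinarith [mul_nonneg (hw j hj) (sq_nonneg (a - y j / 2))]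

/-- A sum of nonnegative reals is at most an upper bound times the number of positive terms. -/
lemma sum_le_mul_card_pos {ι : Type*} (s : Finset ι) (w : ι → ℝ) (hw : ∀ j ∈ s, 0 ≤ w j) (c : ℝ)
    (hc : ∀ j ∈ s, 0 < w j → w j ≤ c) :
    ∑ j ∈ s, w j ≤ c * #{j ∈ s | 0 < w j} := by
  rw [← sum_filter_of_ne (p := fun j => 0 < w j) fun j hj hne => (hw j hj).lt_of_ne' hne,
    mul_comm, ← nsmul_eq_mul]
  exact sum_le_card_nsmul _ _ _ fun j hj => hc j (mem_filter.1 hj).1 (mem_filter.1 hj).2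

/-- inter-sample derivative bound for the periodic law: for a
weight-balanced digraph with Laplacian `L`, out-degrees `dᵢ > 0`, `w_max`, `|𝒩_max|`,
`σᵢ ∈ (0,1)`, `σ_max = maxᵢ σᵢ`, sampling period `h > 0`: if `x̂, e ∈ ℝᴺ` satisfy
`eᵢ² ≤ (σᵢ/(4dᵢ)) ∑ⱼ wᵢⱼ(x̂ᵢ - x̂ⱼ)²` for all `i`, then for every `s ∈ [0, h]`,
`-x̂ᵀ L x̂ + (e + s L x̂)ᵀ L x̂ ≤ ((σ_max - 1)/2 + 2 h w_max |𝒩_max|) x̂ᵀ L x̂`. -/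
theorem intersample_derivative_bound
    (N : ℕ) (hN : 0 < N) (W : Matrix (Fin N) (Fin N) ℝ)
    (hWnn : ∀ i j, 0 ≤ W i j) (hWdiag : ∀ i, W i i = 0)
    (hbal : ∀ i, ∑ j, W i j = ∑ j, W j i)
    (hd : ∀ i, 0 < ∑ j, W i j)
    (hne : ∀ i, (Finset.univ.filter (fun j => 0 < W i j)).Nonempty)
    (L : Matrix (Fin N) (Fin N) ℝ)
    (hL : L = Matrix.diagonal (fun i => ∑ k, W i k) - W)
    (σ : Fin N → ℝ) (hσ : ∀ i, σ i ∈ Set.Ioo (0 : ℝ) 1)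
    (wmax Nmax σmax : ℝ)
    (hwmax : wmax = Finset.univ.sup' ⟨⟨0, hN⟩, Finset.mem_univ _⟩
      (fun i => (Finset.univ.filter (fun j => 0 < W i j)).sup' (hne i) (fun j => W i j)))
    (hNmax : Nmax = Finset.univ.sup' ⟨⟨0, hN⟩, Finset.mem_univ _⟩
      (fun i => ((Finset.univ.filter (fun j => 0 < W i j)).card : ℝ)))
    (hσmax : σmax = Finset.univ.sup' ⟨⟨0, hN⟩, Finset.mem_univ _⟩ σ)
    (h : ℝ) (hh : 0 < h)
    (xhat e : Fin N → ℝ)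
    (htrig : ∀ i, (e i)^2 ≤
      σ i / (4 * ∑ j, W i j) * ∑ j, W i j * (xhat i - xhat j)^2) :
    ∀ s ∈ Set.Icc (0 : ℝ) h,
      -(xhat ⬝ᵥ L.mulVec xhat) + (e + s • L.mulVec xhat) ⬝ᵥ L.mulVec xhat
        ≤ ((σmax - 1) / 2 + 2 * h * wmax * Nmax) * (xhat ⬝ᵥ L.mulVec xhat) := by
  rintro s ⟨hs0, hsh⟩
  have hwle : ∀ i j, 0 < W i j → W i j ≤ wmax := fun i j hij => by
    rw [hwmax]
    exact (le_sup' (fun j => W i j) (mem_filter.2 ⟨mem_univ j, hij⟩)).trans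
      (le_sup' (fun i => (univ.filter fun j => 0 < W i j).sup' (hne i) fun j => W i j)
        (mem_univ i))
  have hNle : ∀ i, (#{j | 0 < W i j} : ℝ) ≤ Nmax := fun i => by
    rw [hNmax]
    exact le_sup' (fun i => (#{j | 0 < W i j} : ℝ)) (mem_univ i)
  have hσle : ∀ i, σ i ≤ σmax := fun i => hσmax ▸ le_sup' σ (mem_univ i)
  have hwmax0 : 0 ≤ wmax := by
    obtain ⟨j, hj⟩ := hne ⟨0, hN⟩
    have hpos := (mem_filter.1 hj).2
    exact hpos.le.trans (hwle _ _ hpos)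
  have hdeg : ∀ i, ∑ j, W i j ≤ wmax * Nmax := fun i =>
    (sum_le_mul_card_pos univ (W i) (fun j _ => hWnn i j) wmax fun j _ => hwle i j).trans
      (mul_le_mul_of_nonneg_left (hNle i) hwmax0)
  have hvertex : ∀ i, (e i + s * ∑ j, W i j * (xhat i - xhat j)) *
      ∑ j, W i j * (xhat i - xhat j) ≤
        ((σmax + 1) / 4 + h * wmax * Nmax) * ∑ j, W i j * (xhat i - xhat j) ^ 2 := by
    intro i
    have hcs := sq_sum_mul_le_sum_mul_sum_mul_sq univ (W i) (fun j => xhat i - xhat j)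
      fun j _ => hWnn i j
    have hyoung := mul_sum_mul_le univ (W i) (fun j => xhat i - xhat j) (fun j _ => hWnn i j) (e i)
    have hφ : 0 ≤ ∑ j, W i j * (xhat i - xhat j) ^ 2 :=
      sum_nonneg fun j _ => mul_nonneg (hWnn i j) (sq_nonneg _)
    have htrig_i := htrig i
    have hdi := hd i
    have hdeg_i := hdeg i
    set d := ∑ j, W i j
    set φ := ∑ j, W i j * (xhat i - xhat j) ^ 2
    set y := ∑ j, W i j * (xhat i - xhat j)
    have herr : d * e i ^ 2 ≤ σmax / 4 * φ := calc
      d * e i ^ 2 ≤ d * (σ i / (4 * d) * φ) := mul_le_mul_of_nonneg_left htrig_i hdi.le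
      _ = σ i / 4 * φ := by field_simp
      _ ≤ σmax / 4 * φ := by gcongr; exact hσle i
    have hdrift : s * y ^ 2 ≤ h * (wmax * Nmax * φ) :=
      mul_le_mul hsh (hcs.trans (mul_le_mul_of_nonneg_right hdeg_i hφ)) (sq_nonneg _) hh.le
    linarith
  have hsum := sum_le_sum fun i (_ : i ∈ univ) => hvertex i
  rw [← mul_sum] at hsum
  have hcross : (e + s • L *ᵥ xhat) ⬝ᵥ L *ᵥ xhat =
      ∑ i, (e i + s * ∑ j, W i j * (xhat i - xhat j)) * ∑ j, W i j * (xhat i - xhat j) := by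
    simp only [hL, dotProduct, Pi.add_apply, Pi.smul_apply, smul_eq_mul, laplacian_mulVec_apply]
  rw [hcross, hL, dotProduct_laplacian_mulVec W hbal]
  linarith
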